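/- Trial-point regret after the first unsuccessful iteration (Lemma A.6). Under the direct-search dynamics driven by the positive spanning set D, let k_f be the index of the first unsuccessful iteration. Then for every v ∈ D and every K ≥ k_f, ∑_{k=k_f}^{K} ( f(x_k + α_k • v) − f(x_k) ) ≤ (1/c)(η + β) · (1/(1 − θ²)) · ( f(x_0) − f(x*) + c α₀² ), where η := (β/(aκθ))(c + β/2). -/

import Mathlib

open RealInnerProductSpace Finset

/-- A function with `β`-Lipschitz gradient lying above its tangents satisfies a quadratic
upper bound. -/
theorem le_add_inner_gradient_add_sq {E : Type*} [NormedAddCommGroup E] [InnerProductSpace ℝ E]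
    [CompleteSpace E] {f : E → ℝ} {β : ℝ}
    (hsmooth : ∀ x y, ‖gradient f x - gradient f y‖ ≤ β * ‖x - y‖)
    (hconv : ∀ x y, f x + ⟪gradient f x, y - x⟫ ≤ f y) (x h : E) :
    f (x + h) ≤ f x + ⟪gradient f x, h⟫ + β * ‖h‖ ^ 2 := by
  have hsupp := hconv (x + h) x
  have hlip := hsmooth (x + h) x
  have hcs := real_inner_le_norm (gradient f (x + h) - gradient f x) h
  rw [show x - (x + h) = -h by abel, inner_neg_right] at hsupp
  rw [add_sub_cancel_left] at hlip
  rw [inner_sub_left] at hcs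
  nlinarith [mul_le_mul_of_nonneg_right hlip (norm_nonneg h)]

/-- The Polyak-Łojasiewicz inequality for a strongly convex function. -/
theorem sub_le_sq_norm_gradient_div {E : Type*} [NormedAddCommGroup E] [InnerProductSpace ℝ E]
    [CompleteSpace E] {f : E → ℝ} {a : ℝ} (ha : 0 < a) {x y : E}
    (hconv : f x + ⟪gradient f x, y - x⟫ + a * ‖y - x‖ ^ 2 ≤ f y) :
    f x - f y ≤ ‖gradient f x‖ ^ 2 / (4 * a) := by
  have hcs := abs_le.1 (abs_real_inner_le_norm (gradient f x) (y - x))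
  rw [le_div_iff₀ (by positivity)]
  nlinarith [sq_nonneg (‖gradient f x‖ - 2 * a * ‖y - x‖)]

/-- The gradient vanishes at a global minimizer. -/
theorem gradient_eq_zero_of_forall_le {E : Type*} [NormedAddCommGroup E] [InnerProductSpace ℝ E]
    [CompleteSpace E] {f : E → ℝ} {x : E} (hmin : ∀ y, f x ≤ f y) : gradient f x = 0 := by
  have hloc : IsLocalMin f x := Filter.Eventually.of_forall hmin
  simp [gradient, hloc.fderiv_eq_zero]

/-- If a poll along directions of cosine measure at least `κ` with step `t` yields no sufficient
decrease, then the gradient is at most proportional to `t`. -/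
theorem norm_gradient_le_of_poll_fails {E : Type*} [NormedAddCommGroup E] [InnerProductSpace ℝ E]
    [CompleteSpace E] {f : E → ℝ} {β κ c t : ℝ} {D : Finset E} {x : E}
    (hβ : 0 ≤ β) (hc : 0 ≤ c) (hκ : 0 < κ) (ht : 0 < t)
    (hunit : ∀ v ∈ D, ‖v‖ = 1) (hcm : ∀ u : E, u ≠ 0 → ∃ v ∈ D, ⟪u, v⟫ ≥ κ * ‖u‖)
    (hupper : ∀ h, f (x + h) ≤ f x + ⟪gradient f x, h⟫ + β * ‖h‖ ^ 2)
    (hfail : ∀ v ∈ D, f x - f (x + t • v) < c * t ^ 2) :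
    ‖gradient f x‖ ≤ (c + β) / κ * t := by
  by_cases hg : gradient f x = 0
  · rw [hg, norm_zero]
    positivity
  obtain ⟨v, hv, hvcm⟩ := hcm (-gradient f x) (neg_ne_zero.2 hg)
  rw [inner_neg_left, norm_neg] at hvcm
  have hstep := hupper (t • v)
  rw [inner_smul_right, norm_smul, hunit v hv, Real.norm_of_nonneg ht.le, mul_one] at hstep
  have hbound : t * (κ * ‖gradient f x‖) ≤ t * ((c + β) * t) := by
    nlinarith [hfail v hv, mul_le_mul_of_nonneg_left hvcm ht.le]
  rw [div_mul_eq_mul_div, le_div_iff₀ hκ, mul_comm]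
  exact le_of_mul_le_mul_left hbound ht

theorem stmt7 {d : ℕ} (hd : 1 ≤ d)
    (f : EuclideanSpace ℝ (Fin d) → ℝ) (a β : ℝ) (ha : 0 < a) (hβ : 0 < β)
    (hdiff : ContDiff ℝ 1 f)
    (hsmooth : ∀ x y : EuclideanSpace ℝ (Fin d), ‖gradient f x - gradient f y‖ ≤ β * ‖x - y‖)
    (hconv : ∀ x y : EuclideanSpace ℝ (Fin d),
      f y ≥ f x + ⟪gradient f x, y - x⟫ + a * ‖y - x‖ ^ 2)
    (xstar : EuclideanSpace ℝ (Fin d)) (hmin : ∀ y, f xstar ≤ f y)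
    (D : Finset (EuclideanSpace ℝ (Fin d))) (hDne : D.Nonempty)
    (hunit : ∀ v ∈ D, ‖v‖ = 1) (κ : ℝ) (hκ : 0 < κ)
    (hcm : ∀ u : EuclideanSpace ℝ (Fin d), u ≠ 0 → ∃ v ∈ D, ⟪u, v⟫ ≥ κ * ‖u‖)
    (α₀ θ c : ℝ) (hα₀ : 0 < α₀) (hθ : θ ∈ Set.Ioo (0 : ℝ) 1) (hc : 0 < c)
    (x : ℕ → EuclideanSpace ℝ (Fin d)) (α : ℕ → ℝ) (S : Set ℕ) (hα0 : α 0 = α₀)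
    (hsucc : ∀ k ∈ S, ∃ v ∈ D, f (x k) - f (x k + α k • v) ≥ c * α k ^ 2 ∧
      x (k + 1) = x k + α k • v ∧ α (k + 1) = α k)
    (hfail : ∀ k ∉ S, (∀ v ∈ D, f (x k) - f (x k + α k • v) < c * α k ^ 2) ∧
      x (k + 1) = x k ∧ α (k + 1) = θ * α k)
    (hne : {n : ℕ | n ∉ S}.Nonempty) (v : EuclideanSpace ℝ (Fin d)) (hv : v ∈ D)
    (K : ℕ) (hK : sInf {n : ℕ | n ∉ S} ≤ K) :
    ∑ k ∈ Finset.Icc (sInf {n : ℕ | n ∉ S}) K, (f (x k + α k • v) - f (x k)) ≤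
      (1 / c) * (((β / (a * κ * θ)) * (c + β / 2)) + β) * (1 / (1 - θ ^ 2)) *
        (f (x 0) - f xstar + c * α₀ ^ 2) := by
  obtain ⟨hθ0, hθ1⟩ := hθ
  set m := sInf {n : ℕ | n ∉ S}
  have hm : m ∉ S := Nat.sInf_mem hne
  have hα : ∀ k, 0 < α k := by
    intro k
    induction k with
    | zero => rwa [hα0]
    | succ k ih =>
      by_cases hk : k ∈ S
      · obtain ⟨w, -, -, -, h⟩ := hsucc k hk
        rwa [h]
      · rw [(hfail k hk).2.2]
        exact mul_pos hθ0 ih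
  have hupper := le_add_inner_gradient_add_sq hsmooth fun x y => by
    nlinarith [hconv x y, sq_nonneg ‖y - x‖]
  have hgstar := gradient_eq_zero_of_forall_le hmin
  set M := (c + β / 2) / κ with hM
  have hMpos : 0 < M := by positivity
  have hgap_fail : ∀ k ∉ S, f (x k) - f xstar ≤ (M * α k) ^ 2 / a := by
    intro k hk
    have hgrad := norm_gradient_le_of_poll_fails hβ.le hc.le hκ (hα k) hunit hcm
      (hupper (x k)) (hfail k hk).1
    have hle : (c + β) / κ ≤ 2 * M := by
      rw [hM, ← mul_div_assoc]
      gcongr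
      linarith
    have hgrad' : ‖gradient f (x k)‖ ≤ 2 * M * α k :=
      hgrad.trans (mul_le_mul_of_nonneg_right hle (hα k).le)
    calc f (x k) - f xstar ≤ ‖gradient f (x k)‖ ^ 2 / (4 * a) :=
          sub_le_sq_norm_gradient_div ha (hconv _ _)
      _ ≤ (2 * M * α k) ^ 2 / (4 * a) := by gcongr
      _ = (M * α k) ^ 2 / a := by field_simp; ring
  have hgap : ∀ k, m ≤ k → f (x k) - f xstar ≤ (M * α k / θ) ^ 2 / a := by
    intro k hk
    induction k, hk using Nat.le_induction with
    | base =>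
      refine (hgap_fail m hm).trans ?_
      have := hα m
      gcongr
      exact le_div_self (by positivity) hθ0 hθ1.le
    | succ k _ ih =>
      by_cases hk : k ∈ S
      · obtain ⟨w, -, hdec, hx, hαk⟩ := hsucc k hk
        rw [hαk, hx]
        nlinarith [sq_nonneg (α k)]
      · rw [(hfail k hk).2.1, (hfail k hk).2.2,
          show M * (θ * α k) / θ = M * α k by field_simp]
        exact hgap_fail k hk
  set η := β / (a * κ * θ) * (c + β / 2) with hη
  have hηpos : 0 < η := by positivity
  have hgrad : ∀ k, m ≤ k → ‖gradient f (x k)‖ ≤ η * α k := by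
    intro k hk
    have hquad := hconv xstar (x k)
    rw [hgstar, inner_zero_left, add_zero] at hquad
    have hdist : ‖x k - xstar‖ ≤ M * α k / θ / a := by
      have := hα k
      refine le_of_sq_le_sq ?_ (by positivity)
      rw [div_pow _ a, le_div_iff₀ (by positivity)]
      have := (le_div_iff₀ ha).1 (hgap k hk)
      nlinarith
    have hlip := hsmooth (x k) xstar
    rw [hgstar, sub_zero] at hlip
    calc ‖gradient f (x k)‖ ≤ β * (M * α k / θ / a) := by
          exact hlip.trans (mul_le_mul_of_nonneg_left hdist hβ.le)
      _ = η * α k := by rw [hη, hM]; field_simp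
  have hterm : ∀ k, m ≤ k → f (x k + α k • v) - f (x k) ≤ (η + β) * α k ^ 2 := by
    intro k hk
    have hstep := hupper (x k) (α k • v)
    have hcs := real_inner_le_norm (gradient f (x k)) (α k • v)
    rw [norm_smul, hunit v hv, Real.norm_of_nonneg (hα k).le, mul_one] at hstep hcs
    nlinarith [mul_le_mul_of_nonneg_right (hgrad k hk) (hα k).le]
  have hθsq : 0 < 1 - θ ^ 2 := by nlinarith
  have hpotential : ∀ k, (1 - θ ^ 2) * c * α k ^ 2 ≤
      (f (x k) + c * α k ^ 2) - (f (x (k + 1)) + c * α (k + 1) ^ 2) := by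
    intro k
    by_cases hk : k ∈ S
    · obtain ⟨w, -, hdec, hx, hαk⟩ := hsucc k hk
      rw [hαk, hx]
      nlinarith [mul_nonneg (sq_nonneg θ) (mul_nonneg hc.le (sq_nonneg (α k)))]
    · rw [(hfail k hk).2.1, (hfail k hk).2.2]
      nlinarith
  have hsum : (1 - θ ^ 2) * c * ∑ k ∈ Finset.range (K + 1), α k ^ 2 ≤
      f (x 0) - f xstar + c * α₀ ^ 2 := by
    have htel := Finset.sum_le_sum fun k (_ : k ∈ Finset.range (K + 1)) => hpotential k
    rw [← Finset.mul_sum,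
      Finset.sum_range_sub' fun k => f (x k) + c * α k ^ 2, hα0] at htel
    nlinarith [hmin (x (K + 1)), mul_nonneg hc.le (sq_nonneg (α (K + 1)))]
  calc ∑ k ∈ Finset.Icc m K, (f (x k + α k • v) - f (x k))
      ≤ ∑ k ∈ Finset.Icc m K, (η + β) * α k ^ 2 :=
        Finset.sum_le_sum fun k hk => hterm k (Finset.mem_Icc.1 hk).1
    _ ≤ ∑ k ∈ Finset.range (K + 1), (η + β) * α k ^ 2 := by
        refine Finset.sum_le_sum_of_subset_of_nonneg (fun k hk => ?_) fun k _ _ => by positivity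
        exact Finset.mem_range_succ_iff.2 (Finset.mem_Icc.1 hk).2
    _ = (η + β) * ∑ k ∈ Finset.range (K + 1), α k ^ 2 := by rw [Finset.mul_sum]
    _ ≤ (η + β) * ((f (x 0) - f xstar + c * α₀ ^ 2) / ((1 - θ ^ 2) * c)) := by
        gcongr
        rwa [le_div_iff₀ (by positivity), mul_comm]
    _ = (1 / c) * (η + β) * (1 / (1 - θ ^ 2)) * (f (x 0) - f xstar + c * α₀ ^ 2) := by
        field_simp
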